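/- Let F be a field, G a finite group, and V a symplectic FG-module that is completely reducible and homogeneous, say V = eW with W irreducible and e > 1, such that every irreducible FG-submodule of V is totally isotropic and self-dual. Then V admits a decomposition as an orthogonal direct sum V = H₁ ⊥ … ⊥ H_t of hyperbolic symplectic FG-submodules, each of dimension 2·dim(W). In particular e = 2t is even. -/

import Mathlib

universe u

section RepDefs

variable {F : Type*} [Field F] {G : Type*} [Group G] {V : Type u}
  [AddCommGroup V] [Module F V]

/-- A subspace `U` is stable under the action (via `ρ`) of the subgroup `N` of `G`. -/
def Stable (ρ : Representation F G V) (N : Subgroup G) (U : Submodule F V) : Prop :=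
  ∀ n ∈ N, ∀ v ∈ U, ρ n v ∈ U

/-- `U` is an irreducible `N`-submodule: it is nonzero and has no proper nonzero
`N`-stable subspaces. -/
def IrredWithin (ρ : Representation F G V) (N : Subgroup G) (U : Submodule F V) : Prop :=
  U ≠ ⊥ ∧ ∀ W : Submodule F V, W ≤ U → Stable ρ N W → W = ⊥ ∨ W = U

/-- The subspaces `U` and `U'` are isomorphic as `N`-modules: there is a linear
equivalence between them commuting with the action of every element of `N`. -/
def IsoWithin (ρ : Representation F G V) (N : Subgroup G) (U U' : Submodule F V) : Prop :=
  ∃ e : U ≃ₗ[F] U', ∀ n ∈ N, ∀ (v : U) (h : ρ n (v : V) ∈ U),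
    ((e ⟨ρ n (v : V), h⟩ : U') : V) = ρ n ((e v : U') : V)

/-- `U` is totally isotropic with respect to the bilinear form `B`. -/
def TotallyIsotropic (B : V →ₗ[F] V →ₗ[F] F) (U : Submodule F V) : Prop :=
  ∀ x ∈ U, ∀ y ∈ U, B x y = 0

/-- The fixed-point subspace of a single group element. -/
def fixedBy (ρ : Representation F G V) (g : G) : Submodule F V :=
  LinearMap.ker (ρ g - LinearMap.id)

/-- `V` is completely reducible as an `N`-module: it is a direct sum of irreducible
`N`-submodules. -/
def CompletelyReducibleOn (ρ : Representation F G V) (N : Subgroup G) : Prop :=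
  ∃ (ι : Type u) (U : ι → Submodule F V), (∀ i, Stable ρ N (U i)) ∧
    (∀ i, IrredWithin ρ N (U i)) ∧ iSupIndep U ∧ ⨆ i, U i = ⊤

/-- The representation of `G` on a `G`-stable subspace `U`. -/
def resRep (ρ : Representation F G V) (U : Submodule F V) (h : Stable ρ ⊤ U) :
    Representation F G ↥U where
  toFun g := (ρ g).restrict (fun v hv => h g (Subgroup.mem_top g) v hv)
  map_one' := by
    ext v
    simp [LinearMap.restrict_apply]
  map_mul' g g' := by
    ext v
    simp [LinearMap.restrict_apply]

/-- A representation is self-dual if it is isomorphic to its dual representation. -/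
def SelfDualRep {W : Type*} [AddCommGroup W] [Module F W] (σ : Representation F G W) : Prop :=
  ∃ e : W ≃ₗ[F] Module.Dual F W, ∀ (g : G) (w : W), e (σ g w) = σ.dual g (e w)

end RepDefs

section HyperbolicDecomposition

variable {F : Type*} [Field F] {G : Type*} [Group G] {V : Type u}
  [AddCommGroup V] [Module F V]

theorem Stable.map {ρ : Representation F G V} {U : Submodule F V} (hU : Stable ρ ⊤ U)
    {p : V →ₗ[F] V} (hp : ∀ g v, p (ρ g v) = ρ g (p v)) : Stable ρ ⊤ (U.map p) := by
  rintro g hg _ ⟨v, hv, rfl⟩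
  exact ⟨ρ g v, hU g hg v hv, hp g v⟩

theorem Stable.comap {ρ : Representation F G V} {U : Submodule F V} (hU : Stable ρ ⊤ U)
    {p : V →ₗ[F] V} (hp : ∀ g v, p (ρ g v) = ρ g (p v)) : Stable ρ ⊤ (U.comap p) := by
  intro g hg v hv
  rw [Submodule.mem_comap, hp]
  exact hU g hg _ hv

theorem Stable.inf {ρ : Representation F G V} {U U' : Submodule F V} (hU : Stable ρ ⊤ U)
    (hU' : Stable ρ ⊤ U') : Stable ρ ⊤ (U ⊓ U') :=
  fun g hg v hv => ⟨hU g hg v hv.1, hU' g hg v hv.2⟩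

theorem Stable.sup {ρ : Representation F G V} {U U' : Submodule F V} (hU : Stable ρ ⊤ U)
    (hU' : Stable ρ ⊤ U') : Stable ρ ⊤ (U ⊔ U') := by
  intro g hg v hv
  obtain ⟨a, ha, b, hb, rfl⟩ := Submodule.mem_sup.1 hv
  rw [map_add]
  exact Submodule.add_mem_sup (hU g hg a ha) (hU' g hg b hb)

theorem stable_bot (ρ : Representation F G V) : Stable ρ ⊤ (⊥ : Submodule F V) := by
  intro g _ v hv
  rw [(Submodule.mem_bot F).1 hv, map_zero]
  exact Submodule.zero_mem _

/-- An irreducible module for a finite group is finite-dimensional. -/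
theorem IrredWithin.finite [Finite G] {ρ : Representation F G V} {U : Submodule F V}
    (hU : IrredWithin ρ ⊤ U) (hst : Stable ρ ⊤ U) : Module.Finite F U := by
  obtain ⟨w, hw, hw0⟩ := Submodule.exists_mem_ne_zero_of_ne_bot hU.1
  set S := Submodule.span F (Set.range fun g => ρ g w) with hS
  have hSst : Stable ρ ⊤ S := by
    intro g _ v hv
    have hle : S ≤ S.comap (ρ g) := by
      rw [hS, Submodule.span_le]
      rintro _ ⟨h, rfl⟩
      refine Submodule.subset_span ⟨g * h, ?_⟩
      simp
    exact hle hv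
  have hSU : S ≤ U := by
    rw [hS, Submodule.span_le]
    rintro _ ⟨h, rfl⟩
    exact hst h (Subgroup.mem_top h) w hw
  have hwS : w ∈ S := Submodule.subset_span ⟨1, by simp⟩
  rcases hU.2 S hSU hSst with h | h
  · exact absurd ((Submodule.mem_bot F).1 (h ▸ hwS)) hw0
  · rw [← h]
    exact Module.Finite.span_of_finite F (Set.finite_range _)

/-- Schur's lemma: an equivariant map kills an irreducible submodule or maps it
isomorphically onto an irreducible submodule. -/
theorem IrredWithin.map {ρ : Representation F G V} {S : Submodule F V}
    (hS : IrredWithin ρ ⊤ S) (hst : Stable ρ ⊤ S)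
    {p : V →ₗ[F] V} (hp : ∀ g v, p (ρ g v) = ρ g (p v)) (hne : S.map p ≠ ⊥) :
    IrredWithin ρ ⊤ (S.map p) ∧ Module.finrank F (S.map p) = Module.finrank F S := by
  refine ⟨⟨hne, fun Z hZ hZst => ?_⟩, ?_⟩
  · rcases hS.2 (Z.comap p ⊓ S) inf_le_right ((hZst.comap hp).inf hst) with h | h
    · left
      rw [eq_bot_iff]
      intro z hz
      obtain ⟨s, hs, rfl⟩ := hZ hz
      have hs0 : s ∈ Z.comap p ⊓ S := ⟨hz, hs⟩
      rw [h, Submodule.mem_bot] at hs0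
      simp [hs0]
    · right
      exact le_antisymm hZ (Submodule.map_le_iff_le_comap.2 (inf_eq_right.1 h))
  · rcases hS.2 (p.ker ⊓ S) inf_le_right (((stable_bot ρ).comap hp).inf hst) with h | h
    · have hinj : Function.Injective (p.domRestrict S) := by
        rw [← LinearMap.ker_eq_bot, eq_bot_iff]
        intro s hs
        have hs0 : (s : V) ∈ p.ker ⊓ S := ⟨hs, s.2⟩
        rw [h, Submodule.mem_bot] at hs0
        exact (Submodule.mem_bot F).2 (Subtype.ext hs0)
      rw [← LinearMap.range_domRestrict, LinearMap.finrank_range_of_inj hinj]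
    · refine absurd ?_ hne
      rw [eq_bot_iff, Submodule.map_le_iff_le_comap]
      exact inf_eq_right.1 h

/-- The form restricted to `U` is nondegenerate. -/
def NondegOn (B : V →ₗ[F] V →ₗ[F] F) (U : Submodule F V) : Prop :=
  ∀ v ∈ U, (∀ w ∈ U, B v w = 0) → v = 0

/-- The equivariant projection onto the orthogonal complement of a nondegenerate stable
subspace. -/
theorem NondegOn.exists_projection {ρ : Representation F G V} {B : V →ₗ[F] V →ₗ[F] F}
    (hGinv : ∀ (g : G) (x y : V), B (ρ g x) (ρ g y) = B x y)
    {H : Submodule F V} [Module.Finite F H] (hst : Stable ρ ⊤ H) (hH : NondegOn B H) :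
    ∃ q : V →ₗ[F] V, (∀ v, v - q v ∈ H) ∧ (∀ v, ∀ h ∈ H, B (q v) h = 0) ∧
      ∀ g v, q (ρ g v) = ρ g (q v) := by
  let res : V →ₗ[F] Module.Dual F H := (LinearMap.lcomp F F H.subtype).comp B
  have hinj : Function.Injective (res.comp H.subtype) := by
    rw [← LinearMap.ker_eq_bot, eq_bot_iff]
    intro x hx
    refine (Submodule.mem_bot F).2 (Subtype.ext (hH x x.2 fun w hw => ?_))
    exact LinearMap.congr_fun (LinearMap.mem_ker.1 hx) ⟨w, hw⟩
  let φ := LinearEquiv.ofInjectiveOfFinrankEq (res.comp H.subtype) hinj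
    Subspace.dual_finrank_eq.symm
  let q : V →ₗ[F] V := LinearMap.id - H.subtype.comp (φ.symm.toLinearMap.comp res)
  have hq1 : ∀ v, v - q v ∈ H := fun v => by simp [q]
  have hq2 : ∀ v, ∀ h ∈ H, B (q v) h = 0 := by
    intro v h hh
    have := LinearMap.congr_fun (φ.apply_symm_apply (res v)) ⟨h, hh⟩
    change B (φ.symm (res v) : V) h = B v h at this
    simp [q, this]
  refine ⟨q, hq1, hq2, fun g v => sub_eq_zero.1 (hH _ ?_ fun w hw => ?_)⟩
  · have h1 := hst g (Subgroup.mem_top g) _ (hq1 v)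
    have h2 := H.sub_mem h1 (hq1 (ρ g v))
    rw [map_sub] at h2
    convert h2 using 1
    abel
  · have h3 : B (ρ g (q v)) w = 0 := by
      have := hGinv g (q v) (ρ g⁻¹ w)
      rw [Representation.self_inv_apply] at this
      rw [this]
      exact hq2 v _ (hst _ (Subgroup.mem_top _) w hw)
    rw [map_sub, LinearMap.sub_apply, hq2 _ w hw, h3, sub_zero]

/-- Two irreducible totally isotropic submodules that are not orthogonal span a nondegenerate
subspace, and they meet trivially. -/
theorem IrredWithin.nondegOn_sup {ρ : Representation F G V} {B : V →ₗ[F] V →ₗ[F] F}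
    (halt : ∀ v : V, B v v = 0)
    (hGinv : ∀ (g : G) (x y : V), B (ρ g x) (ρ g y) = B x y)
    {X Y : Submodule F V} (hX : IrredWithin ρ ⊤ X) (hY : IrredWithin ρ ⊤ Y)
    (hXst : Stable ρ ⊤ X) (hYst : Stable ρ ⊤ Y)
    (hXX : TotallyIsotropic B X) (hYY : TotallyIsotropic B Y)
    (hXY : ∃ y ∈ Y, ∃ x ∈ X, B y x ≠ 0) :
    NondegOn B (Y ⊔ X) ∧ Y ⊓ X = ⊥ := by
  have hskew : ∀ x y, B x y = 0 → B y x = 0 :=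
    (LinearMap.IsAlt.isRefl (B := B) halt)
  have key : ∀ {S T : Submodule F V}, IrredWithin ρ ⊤ S → Stable ρ ⊤ S → Stable ρ ⊤ T →
      (∃ s ∈ S, ∃ t ∈ T, B s t ≠ 0) → ∀ s ∈ S, (∀ t ∈ T, B s t = 0) → s = 0 := by
    intro S T hS hSst hTst ⟨s₀, hs₀, t₀, ht₀, hne⟩ s hs hperp
    let P : Submodule F V :=
      { carrier := {v | ∀ t ∈ T, B v t = 0}
        add_mem' := fun ha hb t ht => by simp [ha t ht, hb t ht]
        zero_mem' := fun t _ => by simp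
        smul_mem' := fun c a ha t ht => by simp [ha t ht] }
    have hPst : Stable ρ ⊤ P := by
      intro g _ v hv t ht
      have := hGinv g v (ρ g⁻¹ t)
      rw [Representation.self_inv_apply] at this
      rw [this]
      exact hv _ (hTst _ (Subgroup.mem_top _) t ht)
    rcases hS.2 (P ⊓ S) inf_le_right (hPst.inf hSst) with h | h
    · exact (Submodule.mem_bot F).1 (h ▸ (⟨hperp, hs⟩ : s ∈ P ⊓ S))
    · exact absurd (inf_eq_right.1 h hs₀ t₀ ht₀) hne
  obtain ⟨y₀, hy₀, x₀, hx₀, hne⟩ := hXY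
  have keyY := key hY hYst hXst ⟨y₀, hy₀, x₀, hx₀, hne⟩
  have keyX := key hX hXst hYst ⟨x₀, hx₀, y₀, hy₀, fun h => hne (hskew _ _ h)⟩
  refine ⟨fun v hv hperp => ?_, ?_⟩
  · obtain ⟨y, hy, x, hx, rfl⟩ := Submodule.mem_sup.1 hv
    have hx0 : x = 0 := keyX x hx fun t ht => by
      simpa [hYY y hy t ht] using hperp t (Submodule.mem_sup_left ht)
    have hy0 : y = 0 := keyY y hy fun t ht => by
      simpa [hx0] using hperp t (Submodule.mem_sup_right ht)
    simp [hx0, hy0]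
  · rw [eq_bot_iff]
    intro v hv
    exact (Submodule.mem_bot F).2 (keyY v hv.1 fun t ht => hXX v hv.2 t ht)

/-- A stable nondegenerate equivariant image of a sum of irreducible submodules, all totally
isotropic and of the same dimension, is an orthogonal sum of hyperbolic planes over them. -/
theorem exists_orthogonal_hyperbolic [FiniteDimensional F V] {ρ : Representation F G V}
    {B : V →ₗ[F] V →ₗ[F] F} (halt : ∀ v : V, B v v = 0)
    (hGinv : ∀ (g : G) (x y : V), B (ρ g x) (ρ g y) = B x y)
    {ι : Type*} {W : ι → Submodule F V} (hstab : ∀ i, Stable ρ ⊤ (W i))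
    (hirr : ∀ i, IrredWithin ρ ⊤ (W i)) (hsup : ⨆ i, W i = ⊤)
    {d : ℕ} (hd : ∀ i, Module.finrank F (W i) = d)
    (hTI : ∀ X : Submodule F V, Stable ρ ⊤ X → IrredWithin ρ ⊤ X → TotallyIsotropic B X)
    (n : ℕ) (U : Submodule F V) (hn : Module.finrank F U ≤ n) (hU : NondegOn B U)
    (p : V →ₗ[F] V) (hp : ∀ g v, p (ρ g v) = ρ g (p v)) (hpU : p.range = U) :
    ∃ (t : ℕ) (H : Fin t → Submodule F V),
      (∀ i, Stable ρ ⊤ (H i)) ∧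
      (∀ i j, i ≠ j → ∀ x ∈ H i, ∀ y ∈ H j, B x y = 0) ∧
      (⨆ i, H i) = U ∧ (∀ i, NondegOn B (H i)) ∧
      (∀ i, Module.finrank F (H i) = 2 * d) ∧
      (∀ i, ∃ L : Submodule F V, L ≤ H i ∧ Stable ρ ⊤ L ∧ TotallyIsotropic B L ∧
        2 * Module.finrank F L = Module.finrank F (H i)) := by
  induction n generalizing U p with
  | zero =>
    have hU0 : U = ⊥ := Submodule.finrank_eq_zero.1 (Nat.le_zero.1 hn)
    exact ⟨0, Fin.elim0, fun i => i.elim0, fun i => i.elim0, by simp [hU0], fun i => i.elim0,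
      fun i => i.elim0, fun i => i.elim0⟩
  | succ n ih =>
    by_cases hU0 : U = ⊥
    · exact ih U (by rw [hU0, finrank_bot]; exact n.zero_le) hU p hp hpU
    have hskew : ∀ x y, B x y = 0 → B y x = 0 :=
      (LinearMap.IsAlt.isRefl (B := B) halt)
    have hUsup : ⨆ i, (W i).map p = U := by
      rw [← Submodule.map_iSup, hsup, Submodule.map_top, hpU]
    have hleU : ∀ i, (W i).map p ≤ U := fun i => hUsup ▸ le_iSup (fun i => (W i).map p) i
    obtain ⟨i, hi⟩ : ∃ i, (W i).map p ≠ ⊥ := by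
      by_contra! h
      exact hU0 (by rw [← hUsup]; simp [h])
    set Y := (W i).map p
    obtain ⟨hYirr, hYd⟩ := (hirr i).map (hstab i) hp hi
    have hYst : Stable ρ ⊤ Y := (hstab i).map hp
    obtain ⟨y, hy, hy0⟩ := Submodule.exists_mem_ne_zero_of_ne_bot hi
    obtain ⟨j, x, hx, hyx⟩ : ∃ j, ∃ x ∈ (W j).map p, B y x ≠ 0 := by
      by_contra! h
      refine hy0 (hU y (hleU i hy) fun w hw => ?_)
      have : U ≤ (B y).ker := hUsup ▸ iSup_le fun j x hx => h j x hx
      exact this hw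
    set X := (W j).map p with hX
    obtain ⟨hXirr, hXd⟩ := (hirr j).map (hstab j) hp
      (fun h => hyx (by
        rw [hX, h, Submodule.mem_bot] at hx
        rw [hx, map_zero]))
    have hXst : Stable ρ ⊤ X := (hstab j).map hp
    obtain ⟨hHnd, hYX⟩ := hXirr.nondegOn_sup halt hGinv hYirr hXst hYst (hTI X hXst hXirr)
      (hTI Y hYst hYirr) ⟨y, hy, x, hx, hyx⟩
    set H₀ := Y ⊔ X with hH₀
    have hH₀st : Stable ρ ⊤ H₀ := hYst.sup hXst
    have hH₀U : H₀ ≤ U := sup_le (hleU i) (hleU j)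
    have hH₀d : Module.finrank F H₀ = 2 * d := by
      have := Submodule.finrank_sup_add_finrank_inf_eq Y X
      rw [hYX, finrank_bot, hYd, hXd, hd, hd] at this
      rw [hH₀]
      omega
    obtain ⟨q, hq1, hq2, hq3⟩ := hHnd.exists_projection hGinv hH₀st
    set U' := (q.comp p).range
    have hU'U : U' ≤ U := by
      rintro _ ⟨v, rfl⟩
      have h1 : p v ∈ U := hpU ▸ ⟨v, rfl⟩
      have := U.sub_mem h1 (hH₀U (hq1 (p v)))
      simpa using this
    have hU'perp : ∀ u ∈ U', ∀ h ∈ H₀, B u h = 0 := by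
      rintro _ ⟨v, rfl⟩ h hh
      exact hq2 _ h hh
    have hsupU : H₀ ⊔ U' = U := by
      refine le_antisymm (sup_le hH₀U hU'U) fun u hu => ?_
      obtain ⟨v, rfl⟩ : u ∈ p.range := hpU ▸ hu
      rw [← sub_add_cancel (p v) (q (p v))]
      exact Submodule.add_mem_sup (hq1 _) ⟨v, rfl⟩
    have hU'nd : NondegOn B U' := by
      refine fun v hv hperp => hU v (hU'U hv) fun w hw => ?_
      obtain ⟨a, ha, b, hb, rfl⟩ := Submodule.mem_sup.1 (hsupU.symm ▸ hw)
      rw [map_add, hU'perp v hv a ha, hperp b hb, add_zero]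
    have hlt : U' < U := by
      refine lt_of_le_of_ne hU'U fun h => hy0 ?_
      have hyH : y ∈ H₀ := Submodule.mem_sup_left hy
      exact hHnd y hyH (hU'perp y (h ▸ hH₀U hyH))
    obtain ⟨t, H, h1, h2, h3, h4, h5, h6⟩ := ih U'
      (by have := Submodule.finrank_lt_finrank_of_lt hlt; omega) hU'nd (q.comp p)
      (fun g v => by simp [hp, hq3]) rfl
    have hHU' : ∀ i, H i ≤ U' := fun i => h3 ▸ le_iSup H i
    refine ⟨t + 1, Fin.cons H₀ H, Fin.cases hH₀st h1, ?_, ?_, Fin.cases hHnd h4,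
      Fin.cases hH₀d h5, Fin.cases ⟨Y, le_sup_left, hYst, hTI Y hYst hYirr, ?_⟩ h6⟩
    · refine Fin.cases (Fin.cases (fun h => absurd rfl h) fun j _ x hx y hy => ?_)
        fun i => Fin.cases (fun _ x hx y hy => ?_) fun j hij => ?_
      · exact hskew _ _ (hU'perp y (hHU' j hy) x hx)
      · exact hU'perp x (hHU' i hx) y hy
      · exact h2 i j fun h => hij (h ▸ rfl)
    · rw [← hsupU, ← h3]
      exact le_antisymm
        (iSup_le (Fin.cases le_sup_left fun i => le_sup_of_le_right (le_iSup H i)))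
        (sup_le (le_iSup (Fin.cons H₀ H : Fin (t + 1) → Submodule F V) 0)
          (iSup_le fun i => le_iSup (Fin.cons H₀ H : Fin (t + 1) → Submodule F V) i.succ))
    · change _ = Module.finrank F H₀
      rw [hH₀d, hYd, hd]

/-- Mutually orthogonal nondegenerate subspaces are independent. -/
theorem iSupIndep_of_orthogonal {B : V →ₗ[F] V →ₗ[F] F} {ι : Type*} {H : ι → Submodule F V}
    (horth : ∀ i j, i ≠ j → ∀ x ∈ H i, ∀ y ∈ H j, B x y = 0)
    (hnd : ∀ i, NondegOn B (H i)) : iSupIndep H := by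
  intro i
  rw [Submodule.disjoint_def]
  intro v hv hv'
  refine hnd i v hv fun w hw => ?_
  have hle : ⨆ j, ⨆ (_ : j ≠ i), H j ≤ (B.flip w).ker :=
    iSup₂_le fun j hj x hx => horth j i hj x hx w hw
  exact hle hv'

theorem finrank_eq_card_mul_of_iSupIndep {ι : Type*} [Fintype ι] [FiniteDimensional F V]
    {H : ι → Submodule F V} (hind : iSupIndep H) (hsup : ⨆ i, H i = ⊤) {d : ℕ}
    (hd : ∀ i, Module.finrank F (H i) = d) : Module.finrank F V = Fintype.card ι * d := by
  classical
  have hint := DirectSum.isInternal_submodule_of_iSupIndep_of_iSup_eq_top hind hsup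
  rw [← (LinearEquiv.ofBijective (DirectSum.coeLinearMap H) hint).finrank_eq,
    Module.finrank_directSum]
  simp [hd]

end HyperbolicDecomposition

/-- If `V` is a symplectic `FG`-module that is completely reducible and homogeneous,
`V = eW` with `W` irreducible and `e > 1`, and every irreducible `FG`-submodule of `V` is
totally isotropic and self-dual, then `V` is an orthogonal direct sum of `t` hyperbolic
symplectic submodules of dimension `2·dim W`; in particular `e = 2t` is even. -/
theorem hyperbolic_decomposition {F : Type*} [Field F] {G : Type*} [Group G] [Finite G]
    {V : Type u} [AddCommGroup V] [Module F V]
    (ρ : Representation F G V)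
    (B : V →ₗ[F] V →ₗ[F] F)
    (halt : ∀ v : V, B v v = 0)
    (hnondeg : ∀ v : V, (∀ w : V, B v w = 0) → v = 0)
    (hGinv : ∀ (g : G) (x y : V), B (ρ g x) (ρ g y) = B x y)
    (e : ℕ) (he : 1 < e)
    (W : Fin e → Submodule F V)
    (hstab : ∀ i, Stable ρ ⊤ (W i))
    (hirrW : ∀ i, IrredWithin ρ ⊤ (W i))
    (hhom : ∀ i j, IsoWithin ρ ⊤ (W i) (W j))
    (hind : iSupIndep W) (hsup : ⨆ i, W i = ⊤)
    (hTIsd : ∀ (X : Submodule F V) (hX : Stable ρ ⊤ X), IrredWithin ρ ⊤ X →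
      TotallyIsotropic B X ∧ SelfDualRep (resRep ρ X hX)) :
    ∃ t : ℕ, e = 2 * t ∧ ∃ H : Fin t → Submodule F V,
      (∀ i, Stable ρ ⊤ (H i)) ∧
      (∀ i j, i ≠ j → ∀ x ∈ H i, ∀ y ∈ H j, B x y = 0) ∧
      iSupIndep H ∧ (⨆ i, H i) = ⊤ ∧
      (∀ i, ∀ v ∈ H i, (∀ w ∈ H i, B v w = 0) → v = 0) ∧
      (∀ i, Module.finrank F ↥(H i) =
        2 * Module.finrank F ↥(W ⟨0, Nat.zero_lt_of_lt he⟩)) ∧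
      (∀ i, ∃ L : Submodule F V, L ≤ H i ∧ Stable ρ ⊤ L ∧ TotallyIsotropic B L ∧
        2 * Module.finrank F ↥L = Module.finrank F ↥(H i)) := by
  have hfin : ∀ i, Module.Finite F (W i) := fun i => (hirrW i).finite (hstab i)
  have hV : FiniteDimensional F V := by
    have : Module.Finite F (⊤ : Submodule F V) := hsup ▸ Submodule.finite_iSup W
    exact Module.finite_def.2 (Module.Finite.iff_fg.1 this)
  set i₀ : Fin e := ⟨0, Nat.zero_lt_of_lt he⟩
  have hd : ∀ i, Module.finrank F (W i) = Module.finrank F (W i₀) := fun i =>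
    (hhom i i₀).choose.finrank_eq
  have hd0 : 0 < Module.finrank F (W i₀) :=
    Nat.pos_of_ne_zero fun h => (hirrW i₀).1 (Submodule.finrank_eq_zero.1 h)
  obtain ⟨t, H, h1, h2, h3, h4, h5, h6⟩ := exists_orthogonal_hyperbolic halt hGinv hstab hirrW
    hsup hd (fun X hX hirr => (hTIsd X hX hirr).1) _ ⊤ le_rfl
    (fun v _ h => hnondeg v fun w => h w trivial) LinearMap.id (fun _ _ => rfl)
    LinearMap.range_id
  have hHind := iSupIndep_of_orthogonal h2 h4
  refine ⟨t, ?_, H, h1, h2, hHind, h3, h4, h5, h6⟩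
  have hW := finrank_eq_card_mul_of_iSupIndep hind hsup hd
  rw [finrank_eq_card_mul_of_iSupIndep hHind h3 h5, Fintype.card_fin, Fintype.card_fin,
    ← mul_assoc] at hW
  rw [mul_comm 2 t]
  exact (Nat.eq_of_mul_eq_mul_right hd0 hW).symm
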